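/- Let X be a nonempty Hausdorff pseudocompact topological space and let {U_n : n ∈ ℕ} be a sequence of almost dense cozero sets of X. Then ⋂_{n=1}^∞ U_n is a nonempty almost dense subset of X. -/

import Mathlib

/-- A subset `A` of a topological space `X` is almost dense if every continuous
real-valued function vanishing on `A` vanishes on all of `X`. -/
def AlmostDense {X : Type*} [TopologicalSpace X] (A : Set X) : Prop :=
  ∀ f : X → ℝ, Continuous f → (∀ a ∈ A, f a = 0) → ∀ x : X, f x = 0

/-- A cozero set of `X` is a set of the form `{x | f x ≠ 0}` for a continuous `f : X → ℝ`. -/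
def IsCozero {X : Type*} [TopologicalSpace X] (C : Set X) : Prop :=
  ∃ f : X → ℝ, Continuous f ∧ C = {x | f x ≠ 0}

/-- A space is pseudocompact if every continuous real-valued function on it is bounded. -/
def Pseudocompact (X : Type*) [TopologicalSpace X] : Prop :=
  ∀ f : X → ℝ, Continuous f → ∃ M : ℝ, ∀ x : X, |f x| ≤ M

theorem AlmostDense.nonempty {X : Type*} [TopologicalSpace X] [Nonempty X] {A : Set X}
    (hA : AlmostDense A) : A.Nonempty := by
  by_contra h
  obtain ⟨x⟩ := ‹Nonempty X›
  exact one_ne_zero (hA (fun _ => 1) continuous_const (fun a ha => (h ⟨a, ha⟩).elim) x)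

/-- The image of an almost dense set under a continuous surjection onto a metrizable space is
dense. -/
theorem AlmostDense.dense_image {X Y : Type*} [TopologicalSpace X] [TopologicalSpace Y]
    [TopologicalSpace.MetrizableSpace Y] {A : Set X} (hA : AlmostDense A) {F : X → Y}
    (hF : Continuous F) (hsurj : Function.Surjective F) : Dense (F '' A) := by
  let _ := TopologicalSpace.metrizableSpaceMetric Y
  intro y
  obtain ⟨x, rfl⟩ := hsurj y
  have : Nonempty X := ⟨x⟩
  rw [Metric.mem_closure_iff_infDist_zero (hA.nonempty.image F)]
  exact hA (fun x => Metric.infDist (F x) (F '' A)) ((Metric.continuous_infDist_pt _).comp hF)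
    (fun a ha => Metric.infDist_zero_of_mem (Set.mem_image_of_mem F ha)) x

/-- A continuous image of a pseudocompact space in a metrizable space is closed. -/
theorem Pseudocompact.isClosed_range {X Y : Type*} [TopologicalSpace X] [TopologicalSpace Y]
    [TopologicalSpace.MetrizableSpace Y] (hX : Pseudocompact X) {F : X → Y}
    (hF : Continuous F) : IsClosed (Set.range F) := by
  let _ := TopologicalSpace.metrizableSpaceMetric Y
  refine isClosed_of_closure_subset fun y hy => ?_
  by_contra hmem
  have hpos : ∀ x, 0 < dist y (F x) := fun x => dist_pos.2 fun h => hmem ⟨x, h.symm⟩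
  obtain ⟨M, hM⟩ := hX (fun x => (dist y (F x))⁻¹)
    ((continuous_const.dist hF).inv₀ fun x => (hpos x).ne')
  have hM' : 0 < |M| + 1 := by positivity
  obtain ⟨_, ⟨x, rfl⟩, hx⟩ := Metric.mem_closure_iff.1 hy (|M| + 1)⁻¹ (inv_pos.2 hM')
  have hlt : |M| + 1 < (dist y (F x))⁻¹ := (lt_inv_comm₀ (hpos x) hM').1 hx
  linarith [hM x, le_abs_self M, le_abs_self (dist y (F x))⁻¹]

/-- A countable intersection of almost dense cozero sets of a pseudocompact space is almost
dense. -/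
theorem Pseudocompact.almostDense_iInter {X : Type*} [TopologicalSpace X]
    (hX : Pseudocompact X) {U : ℕ → Set X} (hcoz : ∀ n, IsCozero (U n))
    (hdense : ∀ n, AlmostDense (U n)) : AlmostDense (⋂ n, U n) := by
  intro f hf hzero x
  choose g hg hU using hcoz
  let F : X → ℝ × (ℕ → ℝ) := fun x => (f x, fun n => g n x)
  have hF : Continuous F := hf.prodMk (continuous_pi hg)
  have : CompleteSpace (Set.range F) := (hX.isClosed_range hF).completeSpace_coe
  let V : ℕ → Set (Set.range F) := fun n => {y | y.1.2 n ≠ 0}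
  have hVo : ∀ n, IsOpen (V n) := fun n => isOpen_ne_fun (by fun_prop) continuous_const
  have hVd : ∀ n, Dense (V n) := fun n => by
    refine ((hdense n).dense_image (hF.codRestrict Set.mem_range_self)
      Set.rangeFactorization_surjective).mono ?_
    rintro _ ⟨a, ha, rfl⟩
    rw [hU n] at ha
    exact ha
  by_contra hx
  obtain ⟨⟨_, a, rfl⟩, hfa, ha⟩ := (dense_iInter_of_isOpen hVo hVd).inter_open_nonempty
    {y : Set.range F | y.1.1 ≠ 0} (isOpen_ne_fun (by fun_prop) continuous_const)
    ⟨⟨F x, x, rfl⟩, hx⟩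
  refine hfa (hzero a (Set.mem_iInter.2 fun n => ?_))
  rw [hU n]
  exact Set.mem_iInter.1 ha n

/-- Baire Category like theorem for Hausdorff pseudocompact spaces. -/
theorem baire_category_like {X : Type*} [TopologicalSpace X] [Nonempty X] [T2Space X]
    (hpc : Pseudocompact X) (U : ℕ → Set X)
    (hcoz : ∀ n, IsCozero (U n)) (hdense : ∀ n, AlmostDense (U n)) :
    (⋂ n, U n).Nonempty ∧ AlmostDense (⋂ n, U n) := by
  have h := hpc.almostDense_iInter hcoz hdense
  exact ⟨h.nonempty, h⟩
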